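/- arXiv:1611.04149 — 9 statements merged into one kernel-verified Lean document; each statement's English description precedes it below -/
import Mathlib

section
/- Let ν > 0, let s ≥ 1 be an integer, and let a be a real number with 0 < a ≤ 2/(s + ν - 1). Then b = (sqrt(a^4 + 4a^2) - a^2)/2 satisfies b ≤ 2/(s + ν). Consequently, for the sequence defined by α_{2,s} = (sqrt(α_{2,s-1}^4 + 4α_{2,s-1}^2) - α_{2,s-1}^2)/2 with α_{2,0} = 2/ν, one has α_{2,s} ≤ 2/(s + ν) for all s ≥ 0. -/
theorem avrbcd_step (t a : ℝ) (ht : 0 < t) (ha : 0 < a) (h : a ≤ 2 / t) :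
    (Real.sqrt (a ^ 4 + 4 * a ^ 2) - a ^ 2) / 2 ≤ 2 / (t + 1) := by
  have h1 : a * t ≤ 2 := (le_div_iff₀ ht).1 h
  have h2 : (a * t) ^ 2 ≤ 4 := by
    have : 0 < a * t := by positivity
    nlinarith
  have hc : 0 < 2 / (t + 1) := by positivity
  have key : a ^ 2 * (1 - 2 / (t + 1)) ≤ (2 / (t + 1)) ^ 2 := by
    have e : (2 / (t + 1)) ^ 2 - a ^ 2 * (1 - 2 / (t + 1))
        = (4 - (a * t) ^ 2 + a ^ 2) / (t + 1) ^ 2 := by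
      field_simp
      ring
    have : 0 ≤ (4 - (a * t) ^ 2 + a ^ 2) / (t + 1) ^ 2 := by
      apply div_nonneg
      · nlinarith [sq_nonneg a]
      · positivity
    linarith
  have : Real.sqrt (a ^ 4 + 4 * a ^ 2) ≤ a ^ 2 + 2 * (2 / (t + 1)) := by
    apply Real.sqrt_le_iff.2
    constructor
    · positivity
    · nlinarith
  linarith

theorem avrbcd_pos (a : ℝ) (ha : 0 < a) :
    0 < (Real.sqrt (a ^ 4 + 4 * a ^ 2) - a ^ 2) / 2 := by
  have : a ^ 2 < Real.sqrt (a ^ 4 + 4 * a ^ 2) := by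
    apply Real.lt_sqrt_of_sq_lt
    nlinarith [pow_pos ha 2]
  linarith

/-- `O(1/s)` decay of the AVRBCD momentum parameters: for `ν > 0`,
(i) if `0 < a ≤ 2/(s + ν - 1)` with `s ≥ 1`, then
`b = (√(a^4 + 4a^2) - a^2)/2` satisfies `b ≤ 2/(s + ν)`; consequently,
(ii) the sequence defined by `α_{2,0} = 2/ν` and
`α_{2,s} = (√(α_{2,s-1}^4 + 4α_{2,s-1}^2) - α_{2,s-1}^2)/2` satisfies
`α_{2,s} ≤ 2/(s + ν)` for all `s ≥ 0`. -/
theorem avrbcd_momentum_decay (ν : ℝ) (hν : 0 < ν) :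
    (∀ s : ℕ, 1 ≤ s → ∀ a : ℝ, 0 < a → a ≤ 2 / ((s : ℝ) + ν - 1) →
      (Real.sqrt (a ^ 4 + 4 * a ^ 2) - a ^ 2) / 2 ≤ 2 / ((s : ℝ) + ν)) ∧
    (∀ α2 : ℕ → ℝ, α2 0 = 2 / ν →
      (∀ s : ℕ,
        α2 (s + 1) = (Real.sqrt ((α2 s) ^ 4 + 4 * (α2 s) ^ 2) - (α2 s) ^ 2) / 2) →
      ∀ s : ℕ, α2 s ≤ 2 / ((s : ℝ) + ν)) := by
  constructor
  · intro s hs a ha h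
    have hs' : (1 : ℝ) ≤ s := by exact_mod_cast hs
    have := avrbcd_step (s + ν - 1) a (by linarith) ha h
    rwa [sub_add_cancel] at this
  · intro α2 h0 hrec s
    have main : ∀ s : ℕ, 0 < α2 s ∧ α2 s ≤ 2 / ((s : ℝ) + ν) := by
      intro s
      induction s with
      | zero =>
        rw [h0]
        refine ⟨by positivity, by simp⟩
      | succ k ih =>
        rw [hrec k]
        refine ⟨avrbcd_pos _ ih.1, ?_⟩
        have := avrbcd_step (k + ν) (α2 k) (by positivity) ih.1 ih.2
        have e : ((k + 1 : ℕ) : ℝ) + ν = k + ν + 1 := by push_cast; ring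
        rwa [e]
    exact (main s).2
end

section
/- Let B ≥ 1 and m ≥ 1 be integers and ν > 2. Set α_{2,0} = 2/ν, let 0 < α_{3,0} ≤ (ν-2)/ν, and α_{1,0} = 1 - α_{2,0} - α_{3,0}; for s ≥ 1 define α_{2,s} = (sqrt(α_{2,s-1}^4 + 4α_{2,s-1}^2) - α_{2,s-1}^2)/2, α_{1,s} = α_{1,s-1}(1 - α_{2,s}), α_{3,s} = 1 - α_{1,s} - α_{2,s}. Let (L̄_s)_{s≥0} be positive reals with L̄_{s+1} ≤ L̄_s for all s. Suppose nonnegative real sequences (d_k)_{k≥0}, (d̃_s)_{s≥0}, (r_k)_{k≥0} satisfy: d̃_0 = d_0; for every s ≥ 0 and every k with sm + 1 ≤ k ≤ (s+1)m, d_k ≤ α_{3,s} d̃_s + α_{1,s} d_{k-1} + (L̄_s α_{2,s}^2 B^2 / 2)(r_{k-1} - r_k); and m d̃_{s+1} ≤ Σ_{j=1}^{m} d_{sm+j} for every s ≥ 0. Then for every s ≥ 1: d̃_s ≤ (α_{2,s}^2 / α_{3,s}) · ( (α_{1,0}/α_{2,0}^2)(d_0/m) + (α_{3,0}/α_{2,0}^2)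 d_0 + (L̄_0 B^2 / (2m)) r_0 ). -/
/-- Theorem 1 of the AVRBCD paper (non-proximal convergence), in sequence form.
Parameters are generated from `α_{2,0} = 2/ν` (`ν > 2`), `0 < α_{3,0} ≤ (ν-2)/ν`,
`α_{1,0} = 1 - α_{2,0} - α_{3,0}` by the AVRBCD recurrences; `L̄_s` is
positive and nonincreasing; the nonnegative sequences `d_k` (iterate
suboptimality), `d̃_s` (snapshot suboptimality) and `r_k` (squared distance to
`x*`) satisfy `d̃_0 = d_0`, the per-iteration inequality of Lemma 1 and the
snapshot inequality `m d̃_{s+1} ≤ ∑_{j=1}^m d_{sm+j}`. Then for every `s ≥ 1`,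
`d̃_s ≤ (α_{2,s}²/α_{3,s})((α_{1,0}/α_{2,0}²)(d_0/m) + (α_{3,0}/α_{2,0}²) d_0
+ (L̄_0 B²/(2m)) r_0)`. -/
theorem avrbcd_nonproximal_convergence (B m : ℕ) (hB : 1 ≤ B) (hm : 1 ≤ m)
    (ν : ℝ) (hν : 2 < ν)
    (α1 α2 α3 : ℕ → ℝ)
    (h20 : α2 0 = 2 / ν) (h30 : 0 < α3 0) (h30' : α3 0 ≤ (ν - 2) / ν)
    (h10 : α1 0 = 1 - α2 0 - α3 0)
    (hrec2 : ∀ s : ℕ,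
      α2 (s + 1) = (Real.sqrt ((α2 s) ^ 4 + 4 * (α2 s) ^ 2) - (α2 s) ^ 2) / 2)
    (hrec1 : ∀ s : ℕ, α1 (s + 1) = α1 s * (1 - α2 (s + 1)))
    (hrec3 : ∀ s : ℕ, α3 (s + 1) = 1 - α1 (s + 1) - α2 (s + 1))
    (L : ℕ → ℝ) (hL : ∀ s, 0 < L s) (hLmono : ∀ s, L (s + 1) ≤ L s)
    (d dt r : ℕ → ℝ)
    (hd : ∀ k, 0 ≤ d k) (hdt : ∀ s, 0 ≤ dt s) (hr : ∀ k, 0 ≤ r k)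
    (hdt0 : dt 0 = d 0)
    (hiter : ∀ s k : ℕ, s * m + 1 ≤ k → k ≤ (s + 1) * m →
      d k ≤ α3 s * dt s + α1 s * d (k - 1) +
        (L s * (α2 s) ^ 2 * (B : ℝ) ^ 2 / 2) * (r (k - 1) - r k))
    (hsnap : ∀ s : ℕ, (m : ℝ) * dt (s + 1) ≤ ∑ j ∈ Finset.Icc 1 m, d (s * m + j)) :
    ∀ s : ℕ, 1 ≤ s →
      dt s ≤ ((α2 s) ^ 2 / α3 s) *
        ((α1 0 / (α2 0) ^ 2) * (d 0 / (m : ℝ)) + (α3 0 / (α2 0) ^ 2) * d 0 +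
          (L 0 * (B : ℝ) ^ 2 / (2 * (m : ℝ))) * r 0) := by
  have hm0 : (0:ℝ) < m := by exact_mod_cast hm
  have hν0 : 0 < ν := by linarith
  have hq : ∀ s, 0 < α2 s → 0 < α2 (s+1) ∧ α2 (s+1) < 1 ∧
      α2 (s+1) ^ 2 = α2 s ^ 2 * (1 - α2 (s+1)) := by
    intro s ha
    have h1 : 0 ≤ (α2 s) ^ 4 + 4 * (α2 s) ^ 2 := by positivity
    have h2 := Real.sq_sqrt h1
    have h3 := Real.sqrt_nonneg ((α2 s) ^ 4 + 4 * (α2 s) ^ 2)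
    have h4 : (α2 s)^2 < Real.sqrt ((α2 s) ^ 4 + 4 * (α2 s) ^ 2) := by
      apply Real.lt_sqrt_of_sq_lt
      nlinarith [pow_pos ha 2]
    have h5 := hrec2 s
    have hpos : 0 < α2 (s+1) := by linarith
    have hsq : α2 (s+1) ^ 2 = α2 s ^ 2 * (1 - α2 (s+1)) := by
      rw [h5]; linear_combination h2 / 4
    refine ⟨hpos, ?_, hsq⟩
    have h6 : 0 < α2 s ^ 2 * (1 - α2 (s+1)) := by rw [← hsq]; positivity
    have := pos_of_mul_pos_right h6 (by positivity)
    linarith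
  have ha : ∀ s, 0 < α2 s := by
    intro s
    induction s with
    | zero => rw [h20]; positivity
    | succ n ih => exact (hq n ih).1
  have hα1 : ∀ s, 0 ≤ α1 s ∧ α1 s < 1 := by
    intro s
    induction s with
    | zero =>
      have h0 := ha 0
      have : (ν - 2) / ν = 1 - 2 / ν := by field_simp
      constructor <;> linarith
    | succ n ih =>
      obtain ⟨p, q, _⟩ := hq n (ha n)
      rw [hrec1]
      constructor
      · exact mul_nonneg ih.1 (by linarith)
      · nlinarith [mul_nonneg ih.1 p.le]
  have hα3 : ∀ s, α3 (s+1) / α2 (s+1) ^ 2 = (1 - α1 s) / α2 s ^ 2 := by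
    intro s
    have h := (hq s (ha s)).2.2
    have p1 := ha s
    have p2 := ha (s+1)
    rw [div_eq_div_iff (by positivity) (by positivity), hrec3, hrec1, h]
    ring
  have hc : ∀ s, α1 (s+1) / α2 (s+1) ^ 2 = α1 s / α2 s ^ 2 := by
    intro s
    have h := (hq s (ha s)).2.2
    have p1 := ha s
    have p2 := ha (s+1)
    rw [div_eq_div_iff (by positivity) (by positivity), hrec1, h]
    ring
  have hsum : ∀ s n : ℕ, n ≤ m →
      (1 - α1 s) * ∑ j ∈ Finset.Icc 1 n, d (s*m+j) + α1 s * d (s*m+n)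
        + (L s * (α2 s) ^ 2 * (B : ℝ) ^ 2 / 2) * r (s*m+n)
      ≤ n * (α3 s * dt s) + α1 s * d (s*m)
        + (L s * (α2 s) ^ 2 * (B : ℝ) ^ 2 / 2) * r (s*m) := by
    intro s n
    induction n with
    | zero => intro _; simp
    | succ n ih =>
      intro hn
      have h1 := ih (by omega)
      have h2 := hiter s (s*m+(n+1)) (by omega) (by rw [Nat.succ_mul]; omega)
      have e : s*m+(n+1)-1 = s*m+n := by omega
      rw [e] at h2
      rw [Finset.sum_Icc_succ_top (by omega)]
      push_cast
      linarith
  have hstep : ∀ s : ℕ,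
      α3 (s+1) / α2 (s+1) ^ 2 * (m * dt (s+1)) + α1 (s+1) / α2 (s+1) ^ 2 * d ((s+1)*m)
        + L (s+1) * (B:ℝ)^2 / 2 * r ((s+1)*m)
      ≤ α3 s / α2 s ^ 2 * (m * dt s) + α1 s / α2 s ^ 2 * d (s*m)
        + L s * (B:ℝ)^2 / 2 * r (s*m) := by
    intro s
    have h1 := hsum s m le_rfl
    have e : s*m+m = (s+1)*m := by ring
    rw [e] at h1
    have h2 := mul_le_mul_of_nonneg_left (hsnap s) (by linarith [(hα1 s).2] : 0 ≤ 1 - α1 s)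
    have h3 : L (s+1) * (B:ℝ)^2 / 2 * r ((s+1)*m) ≤ L s * (B:ℝ)^2 / 2 * r ((s+1)*m) := by
      have := hLmono s
      have := hr ((s+1)*m)
      gcongr
    rw [hα3, hc]
    have p := ha s
    have p2 : 0 < α2 s ^ 2 := by positivity
    refine (add_le_add_right h3 _).trans ?_
    rw [← sub_nonneg]
    have h4 : 0 ≤ ((m * (α3 s * dt s) + α1 s * d (s*m)
        + (L s * (α2 s) ^ 2 * (B : ℝ) ^ 2 / 2) * r (s*m))
        - ((1 - α1 s) * (m * dt (s+1)) + α1 s * d ((s+1)*m)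
        + (L s * (α2 s) ^ 2 * (B : ℝ) ^ 2 / 2) * r ((s+1)*m))) / α2 s ^ 2 :=
      div_nonneg (by linarith) p2.le
    refine h4.trans (le_of_eq ?_)
    field_simp
    try ring
  have hV : ∀ s : ℕ,
      α3 s / α2 s ^ 2 * (m * dt s) + α1 s / α2 s ^ 2 * d (s*m)
        + L s * (B:ℝ)^2 / 2 * r (s*m)
      ≤ α3 0 / α2 0 ^ 2 * (m * d 0) + α1 0 / α2 0 ^ 2 * d 0
        + L 0 * (B:ℝ)^2 / 2 * r 0 := by
    intro s
    induction s with
    | zero => simp [hdt0]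
    | succ n ih => exact (hstep n).trans ih
  intro s hs
  obtain ⟨t, rfl⟩ : ∃ t, s = t + 1 := ⟨s - 1, by omega⟩
  have p := ha (t+1)
  have p3 : 0 < α3 (t+1) / α2 (t+1) ^ 2 := by
    rw [hα3]
    have := ha t
    have := (hα1 t).2
    exact div_pos (by linarith) (by positivity)
  have h1 := hV (t+1)
  have h2 : 0 ≤ α1 (t+1) / α2 (t+1) ^ 2 * d ((t+1)*m) :=
    mul_nonneg (div_nonneg (hα1 _).1 (by positivity)) (hd _)
  have h3 : 0 ≤ L (t+1) * (B:ℝ)^2 / 2 * r ((t+1)*m) := by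
    have := hL (t+1)
    have := hr ((t+1)*m)
    positivity
  have h4 : α3 (t+1) / α2 (t+1) ^ 2 * (m * dt (t+1)) ≤ α3 0 / α2 0 ^ 2 * (m * d 0)
      + α1 0 / α2 0 ^ 2 * d 0 + L 0 * (B:ℝ)^2 / 2 * r 0 := by linarith
  have e : (α2 (t+1)) ^ 2 / α3 (t+1) = (α3 (t+1) / α2 (t+1) ^ 2)⁻¹ := by rw [inv_div]
  rw [e, ← div_eq_inv_mul, le_div_iff₀ p3]
  refine le_of_mul_le_mul_left ?_ hm0
  calc (m:ℝ) * (dt (t+1) * (α3 (t+1) / α2 (t+1) ^ 2))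
      = α3 (t+1) / α2 (t+1) ^ 2 * (m * dt (t+1)) := by ring
    _ ≤ _ := h4
    _ = _ := by field_simp; ring
end

section
/- Let B ≥ 2 and m ≥ 1 be integers. Set α_{2,0} = α_{3,0} = 1/(2B) and α_{1,0} = 1 - 1/B; for s ≥ 1 define α_{2,s} = (sqrt(α_{2,s-1}^4 + 4α_{2,s-1}^2) - α_{2,s-1}^2)/2, α_{1,s} = α_{1,s-1}(1 - α_{2,s}), α_{3,s} = 1 - α_{1,s} - α_{2,s}. Let (L̄_s)_{s≥0} be positive reals with L̄_{s+1} ≤ L̄_s. Suppose real sequences (d_k)_{k≥0}, (d̂_k)_{k≥0}, (d̃_s)_{s≥0}, (r_k)_{k≥0} satisfy: 0 ≤ d_k ≤ d̂_k and r_k ≥ 0 and d̃_s ≥ 0 for all k, s; d̂_0 = d_0 and d̃_0 = d_0; for every s ≥ 0 and every k with sm + 1 ≤ k ≤ (s+1)m, d̂_k ≤ α_{3,s} d̃_s + α_{1,s} d̂_{k-1} + (L̄_s α_{2,s}^2 B^2 / 2)(r_{k-1} - r_k); and m d̃_{s+1} ≤ Σ_{j=1}^{m} d_{sm+j} for every s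 ≥ 0. Then for every s ≥ 1: d̃_s ≤ (α_{2,s}^2 / α_{3,s}) · ( (α_{1,0}/α_{2,0}^2)(d_0/m) + (α_{3,0}/α_{2,0}^2) d_0 + (L̄_0 B^2 / (2m)) r_0 ). -/
/-- Theorem 2 of the AVRBCD paper (proximal convergence), in sequence form.
With `B ≥ 2`, parameters generated from `α_{2,0} = α_{3,0} = 1/(2B)`,
`α_{1,0} = 1 - 1/B` by the AVRBCD recurrences, nonincreasing positive `L̄_s`,
and sequences `0 ≤ d_k ≤ d̂_k`, `r_k ≥ 0`, `d̃_s ≥ 0` with `d̂_0 = d̃_0 = d_0`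
satisfying the per-iteration inequality of Lemma 3 and the snapshot inequality
`m d̃_{s+1} ≤ ∑_{j=1}^m d_{sm+j}`, one has for every `s ≥ 1`:
`d̃_s ≤ (α_{2,s}²/α_{3,s})((α_{1,0}/α_{2,0}²)(d_0/m) + (α_{3,0}/α_{2,0}²) d_0
+ (L̄_0 B²/(2m)) r_0)`. -/
theorem avrbcd_proximal_convergence (B m : ℕ) (hB : 2 ≤ B) (hm : 1 ≤ m)
    (α1 α2 α3 : ℕ → ℝ)
    (h20 : α2 0 = 1 / (2 * (B : ℝ))) (h30 : α3 0 = 1 / (2 * (B : ℝ)))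
    (h10 : α1 0 = 1 - 1 / (B : ℝ))
    (hrec2 : ∀ s : ℕ,
      α2 (s + 1) = (Real.sqrt ((α2 s) ^ 4 + 4 * (α2 s) ^ 2) - (α2 s) ^ 2) / 2)
    (hrec1 : ∀ s : ℕ, α1 (s + 1) = α1 s * (1 - α2 (s + 1)))
    (hrec3 : ∀ s : ℕ, α3 (s + 1) = 1 - α1 (s + 1) - α2 (s + 1))
    (L : ℕ → ℝ) (hL : ∀ s, 0 < L s) (hLmono : ∀ s, L (s + 1) ≤ L s)
    (d dh dt r : ℕ → ℝ)
    (hd : ∀ k, 0 ≤ d k) (hdh : ∀ k, d k ≤ dh k)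
    (hr : ∀ k, 0 ≤ r k) (hdt : ∀ s, 0 ≤ dt s)
    (hdh0 : dh 0 = d 0) (hdt0 : dt 0 = d 0)
    (hiter : ∀ s k : ℕ, s * m + 1 ≤ k → k ≤ (s + 1) * m →
      dh k ≤ α3 s * dt s + α1 s * dh (k - 1) +
        (L s * (α2 s) ^ 2 * (B : ℝ) ^ 2 / 2) * (r (k - 1) - r k))
    (hsnap : ∀ s : ℕ, (m : ℝ) * dt (s + 1) ≤ ∑ j ∈ Finset.Icc 1 m, d (s * m + j)) :
    ∀ s : ℕ, 1 ≤ s →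
      dt s ≤ ((α2 s) ^ 2 / α3 s) *
        ((α1 0 / (α2 0) ^ 2) * (d 0 / (m : ℝ)) + (α3 0 / (α2 0) ^ 2) * d 0 +
          (L 0 * (B : ℝ) ^ 2 / (2 * (m : ℝ))) * r 0) := by
  have hB' : (2:ℝ) ≤ B := by exact_mod_cast hB
  have hm' : (0:ℝ) < m := by exact_mod_cast hm
  have hsq : ∀ s, 0 < α2 s → 0 < α2 (s+1) ∧ α2 (s+1) < 1 ∧
      (α2 (s+1))^2 = (α2 s)^2 * (1 - α2 (s+1)) := by
    intro s hs
    have h0 : 0 ≤ (α2 s)^4 + 4 * (α2 s)^2 := by positivity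
    have h1 := Real.sq_sqrt h0
    have h2 := Real.sqrt_nonneg ((α2 s)^4 + 4 * (α2 s)^2)
    have h3 := hrec2 s
    set q := Real.sqrt ((α2 s)^4 + 4 * (α2 s)^2)
    have hp : 0 < (α2 s)^2 := by positivity
    have e : (α2 (s+1))^2 = (α2 s)^2 * (1 - α2 (s+1)) := by
      rw [h3]; linear_combination h1 / 4
    have hpos : 0 < α2 (s+1) := by
      have : (α2 s)^2 < q := by
        apply lt_of_pow_lt_pow_left₀ 2 h2
        rw [h1]; nlinarith
      rw [h3]; linarith
    refine ⟨hpos, ?_, e⟩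
    have : 0 < (α2 s)^2 * (1 - α2 (s+1)) := by rw [← e]; positivity
    have := pos_of_mul_pos_right this hp.le
    linarith
  have hα2 : ∀ s, 0 < α2 s := by
    intro s
    induction s with
    | zero => rw [h20]; positivity
    | succ s ih => exact (hsq s ih).1
  have hα1 : ∀ s, 0 ≤ α1 s ∧ α1 s < 1 := by
    intro s
    induction s with
    | zero =>
      rw [h10]
      have h1 : 0 < 1 / (B:ℝ) := by positivity
      have h2 : 1 / (B:ℝ) ≤ 1 := by rw [div_le_one (by linarith)]; linarith
      constructor <;> linarith
    | succ s ih =>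
      obtain ⟨h1, h2, -⟩ := hsq s (hα2 s)
      rw [hrec1]
      exact ⟨mul_nonneg ih.1 (by linarith), by nlinarith [ih.1, ih.2]⟩
  have h3eq : ∀ s, α3 (s+1) = (1 - α1 s) * (1 - α2 (s+1)) := by
    intro s
    rw [hrec3, hrec1]; ring
  have hα3 : ∀ s, 0 < α3 s := by
    intro s
    cases s with
    | zero => rw [h30]; positivity
    | succ s =>
      rw [h3eq]
      exact mul_pos (by linarith [(hα1 s).2]) (by linarith [(hsq s (hα2 s)).2.1])
  -- partial sums over an epoch
  have hsum : ∀ s n, n ≤ m →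
      (1 - α1 s) * ∑ j ∈ Finset.Icc 1 n, dh (s*m+j) + α1 s * dh (s*m+n) ≤
        n * (α3 s * dt s) + α1 s * dh (s*m) +
          (L s * (α2 s)^2 * (B:ℝ)^2 / 2) * (r (s*m) - r (s*m+n)) := by
    intro s n
    induction n with
    | zero => intro _; simp
    | succ n ih =>
      intro hn
      have ih' := ih (by omega)
      have h := hiter s (s*m+(n+1)) (by omega) (by rw [add_mul, one_mul]; omega)
      rw [show s*m+(n+1)-1 = s*m+n by omega] at h
      rw [Finset.sum_Icc_succ_top (by omega)]
      push_cast
      linarith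
  have hstep : ∀ s, m * (α3 (s+1) / (α2 (s+1))^2) * dt (s+1)
        + α1 (s+1) / (α2 (s+1))^2 * dh ((s+1)*m) + L (s+1) * (B:ℝ)^2/2 * r ((s+1)*m)
      ≤ m * (α3 s / (α2 s)^2) * dt s
        + α1 s / (α2 s)^2 * dh (s*m) + L s * (B:ℝ)^2/2 * r (s*m) := by
    intro s
    obtain ⟨h1, h2, h3⟩ := hsq s (hα2 s)
    have hne : (1 - α2 (s+1)) ≠ 0 := by linarith
    have ha := hα2 s
    have e3 : α3 (s+1) / (α2 (s+1))^2 = (1 - α1 s) / (α2 s)^2 := by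
      rw [h3eq, h3, mul_div_mul_right _ _ hne]
    have e1 : α1 (s+1) / (α2 (s+1))^2 = α1 s / (α2 s)^2 := by
      rw [hrec1, h3, mul_div_mul_right _ _ hne]
    rw [e3, e1, show (s+1)*m = s*m+m by ring]
    have hS := hsum s m le_rfl
    have hle : (m:ℝ) * dt (s+1) ≤ ∑ j ∈ Finset.Icc 1 m, dh (s*m+j) :=
      (hsnap s).trans (Finset.sum_le_sum fun j _ => hdh _)
    have hle2 := mul_le_mul_of_nonneg_left hle (by linarith [(hα1 s).2] : 0 ≤ 1 - α1 s)
    have hLr : L (s+1) * (B:ℝ)^2/2 * r (s*m+m) ≤ L s * (B:ℝ)^2/2 * r (s*m+m) := by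
      have := hLmono s
      have := hr (s*m+m)
      gcongr
    have hmain : (1 - α1 s) * (m * dt (s+1)) + α1 s * dh (s*m+m) ≤
        m * (α3 s * dt s) + α1 s * dh (s*m) +
          (L s * (α2 s)^2 * (B:ℝ)^2 / 2) * (r (s*m) - r (s*m+m)) := by linarith
    have hdiv := div_le_div_of_nonneg_right hmain (by positivity : 0 ≤ (α2 s)^2)
    have l : ((1 - α1 s) * (m * dt (s+1)) + α1 s * dh (s*m+m)) / (α2 s)^2 =
      m * ((1 - α1 s) / (α2 s)^2) * dt (s+1) + α1 s / (α2 s)^2 * dh (s*m+m) := by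
      field_simp
    have rr : (m * (α3 s * dt s) + α1 s * dh (s*m) +
          (L s * (α2 s)^2 * (B:ℝ)^2 / 2) * (r (s*m) - r (s*m+m))) / (α2 s)^2 =
      m * (α3 s / (α2 s)^2) * dt s + α1 s / (α2 s)^2 * dh (s*m)
        + L s * (B:ℝ)^2/2 * (r (s*m) - r (s*m+m)) := by
      field_simp
    rw [l, rr] at hdiv
    linarith
  have hpot : ∀ s, m * (α3 s / (α2 s)^2) * dt s
        + α1 s / (α2 s)^2 * dh (s*m) + L s * (B:ℝ)^2/2 * r (s*m)
      ≤ m * (α3 0 / (α2 0)^2) * d 0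
        + α1 0 / (α2 0)^2 * d 0 + L 0 * (B:ℝ)^2/2 * r 0 := by
    intro s
    induction s with
    | zero => simp [hdt0, hdh0]
    | succ s ih => exact (hstep s).trans ih
  intro s _
  have hp := hpot s
  have ha := hα2 s
  have h3 := hα3 s
  have n1 : 0 ≤ α1 s / (α2 s)^2 * dh (s*m) :=
    mul_nonneg (div_nonneg (hα1 s).1 (by positivity)) ((hd _).trans (hdh _))
  have n2 : 0 ≤ L s * (B:ℝ)^2/2 * r (s*m) := by
    have := hL s
    have := hr (s*m)
    positivity
  have key : m * (α3 s / (α2 s)^2) * dt s ≤ m * (α3 0 / (α2 0)^2) * d 0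
        + α1 0 / (α2 0)^2 * d 0 + L 0 * (B:ℝ)^2/2 * r 0 := by linarith
  have hc : 0 ≤ (α2 s)^2 / α3 s / m := by positivity
  have := mul_le_mul_of_nonneg_left key hc
  have e : (α2 s)^2 / α3 s / m * (m * (α3 s / (α2 s)^2) * dt s) = dt s := by
    field_simp
  rw [e] at this
  refine this.trans (le_of_eq ?_)
  have ha0 := hα2 0
  field_simp
  try ring
end

section
/- Let ν > 0, α_{2,0} = 2/ν and α_{3,0} ∈ (0,1); let α_{1,0} ≥ 0 with α_{1,0} + α_{2,0} + α_{3,0} = 1, and for s ≥ 1 define α_{2,s} = (sqrt(α_{2,s-1}^4 + 4α_{2,s-1}^2) - α_{2,s-1}^2)/2, α_{1,s} = α_{1,s-1}(1 - α_{2,s}), α_{3,s} = 1 - α_{1,s} - α_{2,s}. Then for every s ≥ 0: α_{2,s}^2 / α_{3,s} ≤ 4 / (α_{3,0} (s + ν)^2). -/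
/-- The quantitative bound underlying Corollaries 1 and 2 of the AVRBCD paper:
with `ν > 0`, `α_{2,0} = 2/ν`, `α_{3,0} ∈ (0,1)`, `α_{1,0} ≥ 0`,
`α_{1,0} + α_{2,0} + α_{3,0} = 1`, and the AVRBCD parameter recurrences, one has
`α_{2,s}²/α_{3,s} ≤ 4/(α_{3,0}(s + ν)²)` for every `s ≥ 0`. -/
theorem avrbcd_rate_bound (ν : ℝ) (hν : 0 < ν)
    (α1 α2 α3 : ℕ → ℝ)
    (h20 : α2 0 = 2 / ν) (h30 : 0 < α3 0) (h30' : α3 0 < 1)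
    (h10 : 0 ≤ α1 0) (hsum : α1 0 + α2 0 + α3 0 = 1)
    (hrec2 : ∀ s : ℕ,
      α2 (s + 1) = (Real.sqrt ((α2 s) ^ 4 + 4 * (α2 s) ^ 2) - (α2 s) ^ 2) / 2)
    (hrec1 : ∀ s : ℕ, α1 (s + 1) = α1 s * (1 - α2 (s + 1)))
    (hrec3 : ∀ s : ℕ, α3 (s + 1) = 1 - α1 (s + 1) - α2 (s + 1)) :
    ∀ s : ℕ, (α2 s) ^ 2 / α3 s ≤ 4 / (α3 0 * ((s : ℝ) + ν) ^ 2) := by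
  have key : ∀ s : ℕ, 0 < α2 s ∧ α2 s * ((s : ℝ) + ν) ≤ 2 ∧ 0 ≤ α1 s ∧
      α1 s + α2 s + α3 s = 1 ∧ α3 0 ≤ α3 s := by
    intro s
    induction s with
    | zero =>
      refine ⟨by rw [h20]; positivity, ?_, h10, hsum, le_refl _⟩
      rw [h20]
      apply le_of_eq
      push_cast
      field_simp
      ring
    | succ s ih =>
      obtain ⟨ha, hat, h1, hs, h3⟩ := ih
      have e2 := hrec2 s
      have e1 := hrec1 s
      have e3 := hrec3 s
      have hr : Real.sqrt ((α2 s) ^ 4 + 4 * (α2 s) ^ 2) ^ 2 = (α2 s) ^ 4 + 4 * (α2 s) ^ 2 :=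
        Real.sq_sqrt (by positivity)
      have hlt : (α2 s) ^ 2 < Real.sqrt ((α2 s) ^ 4 + 4 * (α2 s) ^ 2) := by
        apply Real.lt_sqrt_of_sq_lt
        nlinarith [pow_pos ha 2]
      have ht : (0 : ℝ) < (s : ℝ) + ν := by positivity
      push_cast
      generalize Real.sqrt ((α2 s) ^ 4 + 4 * (α2 s) ^ 2) = r at *
      generalize α2 (s + 1) = b at *
      generalize α2 s = a at *
      generalize (s : ℝ) = x at *
      have hb : 0 < b := by rw [e2]; linarith
      have hq : b ^ 2 = a ^ 2 * (1 - b) := by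
        rw [e2]; linear_combination hr / 4
      have ha2 : 0 < a ^ 2 := by positivity
      have hb1 : 0 < 1 - b := by
        have h : 0 < a ^ 2 * (1 - b) := by rw [← hq]; positivity
        exact (pos_iff_pos_of_mul_pos h).1 ha2
      have hba : b ≤ a := by
        refine (sq_le_sq₀ hb.le ha.le).1 ?_
        nlinarith [mul_pos ha2 hb]
      have hbt : b * (x + ν) ≤ 2 - b := by
        refine (sq_le_sq₀ (by positivity) (by linarith)).1 ?_
        have h4 : (a * (x + ν)) ^ 2 ≤ 2 ^ 2 := by gcongr
        have h5 : (b * (x + ν)) ^ 2 = (a * (x + ν)) ^ 2 * (1 - b) := by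
          linear_combination (x + ν) ^ 2 * hq
        nlinarith [mul_le_mul_of_nonneg_right h4 hb1.le, sq_nonneg b]
      refine ⟨hb, by linarith, ?_, by linarith, ?_⟩
      · rw [e1]; positivity
      · rw [e3, e1]
        nlinarith [mul_nonneg h1 hb.le]
  intro s
  obtain ⟨ha, hat, -, -, h3⟩ := key s
  have ht : (0 : ℝ) < (s : ℝ) + ν := by positivity
  have h4 : (α2 s * ((s : ℝ) + ν)) ^ 2 ≤ 2 ^ 2 := by gcongr
  rw [div_le_div_iff₀ (by linarith) (by positivity)]
  calc α2 s ^ 2 * (α3 0 * ((s : ℝ) + ν) ^ 2) = (α2 s * ((s : ℝ) + ν)) ^ 2 * α3 0 := by ring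
    _ ≤ 2 ^ 2 * α3 s := by gcongr
    _ = 4 * α3 s := by norm_num
end

section
/- Under the hypotheses of the sequence form of Theorem 1 (parameters α_{i,s} generated from α_{2,0} = 2/ν with ν > 2, 0 < α_{3,0} ≤ (ν-2)/ν, α_{1,0} = 1 - α_{2,0} - α_{3,0}; nonincreasing positive L̄_s; nonnegative sequences d_k, d̃_s, r_k with d̃_0 = d_0 satisfying d_k ≤ α_{3,s} d̃_s + α_{1,s} d_{k-1} + (L̄_s α_{2,s}^2 B^2/2)(r_{k-1} - r_k) for sm+1 ≤ k ≤ (s+1)m and m d̃_{s+1} ≤ Σ_{j=1}^m d_{sm+j}), one has for every s ≥ 1: d̃_s ≤ (4 / (α_{3,0}(s+ν)^2)) · ( (α_{1,0}/α_{2,0}^2)(d_0/m) + (α_{3,0}/α_{2,0}^2) d_0 + (L̄_0 B^2/(2m)) r_0 ). In particular d̃_s = O(1/s²). -/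
/-- Corollary 1 of the AVRBCD paper in explicit form: under the hypotheses of
the sequence form of Theorem 1 (parameters from `α_{2,0} = 2/ν`, `ν > 2`,
`0 < α_{3,0} ≤ (ν-2)/ν`, `α_{1,0} = 1 - α_{2,0} - α_{3,0}`; nonincreasing
positive `L̄_s`; nonnegative sequences `d_k, d̃_s, r_k` with `d̃_0 = d_0`,
the per-iteration inequality and the snapshot inequality), the snapshot
suboptimality satisfies, for every `s ≥ 1`,
`d̃_s ≤ (4/(α_{3,0}(s+ν)²))((α_{1,0}/α_{2,0}²)(d_0/m) + (α_{3,0}/α_{2,0}²) d_0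
+ (L̄_0 B²/(2m)) r_0)`, i.e. `d̃_s = O(1/s²)`. -/
theorem avrbcd_nonproximal_rate (B m : ℕ) (hB : 1 ≤ B) (hm : 1 ≤ m)
    (ν : ℝ) (hν : 2 < ν)
    (α1 α2 α3 : ℕ → ℝ)
    (h20 : α2 0 = 2 / ν) (h30 : 0 < α3 0) (h30' : α3 0 ≤ (ν - 2) / ν)
    (h10 : α1 0 = 1 - α2 0 - α3 0)
    (hrec2 : ∀ s : ℕ,
      α2 (s + 1) = (Real.sqrt ((α2 s) ^ 4 + 4 * (α2 s) ^ 2) - (α2 s) ^ 2) / 2)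
    (hrec1 : ∀ s : ℕ, α1 (s + 1) = α1 s * (1 - α2 (s + 1)))
    (hrec3 : ∀ s : ℕ, α3 (s + 1) = 1 - α1 (s + 1) - α2 (s + 1))
    (L : ℕ → ℝ) (hL : ∀ s, 0 < L s) (hLmono : ∀ s, L (s + 1) ≤ L s)
    (d dt r : ℕ → ℝ)
    (hd : ∀ k, 0 ≤ d k) (hdt : ∀ s, 0 ≤ dt s) (hr : ∀ k, 0 ≤ r k)
    (hdt0 : dt 0 = d 0)
    (hiter : ∀ s k : ℕ, s * m + 1 ≤ k → k ≤ (s + 1) * m →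
      d k ≤ α3 s * dt s + α1 s * d (k - 1) +
        (L s * (α2 s) ^ 2 * (B : ℝ) ^ 2 / 2) * (r (k - 1) - r k))
    (hsnap : ∀ s : ℕ, (m : ℝ) * dt (s + 1) ≤ ∑ j ∈ Finset.Icc 1 m, d (s * m + j)) :
    ∀ s : ℕ, 1 ≤ s →
      dt s ≤ (4 / (α3 0 * ((s : ℝ) + ν) ^ 2)) *
        ((α1 0 / (α2 0) ^ 2) * (d 0 / (m : ℝ)) + (α3 0 / (α2 0) ^ 2) * d 0 +
          (L 0 * (B : ℝ) ^ 2 / (2 * (m : ℝ))) * r 0) := by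
  have hν0 : 0 < ν := by linarith
  have hmpos : (0 : ℝ) < m := by exact_mod_cast hm
  -- basic facts on α2
  have key : ∀ s, 0 < α2 s → 0 < α2 (s + 1) ∧
      (α2 (s + 1)) ^ 2 = (1 - α2 (s + 1)) * (α2 s) ^ 2 := by
    intro s hs
    have hsq := Real.sq_sqrt (show 0 ≤ (α2 s) ^ 4 + 4 * (α2 s) ^ 2 by positivity)
    have hlt : (α2 s) ^ 2 < Real.sqrt ((α2 s) ^ 4 + 4 * (α2 s) ^ 2) := by
      apply Real.lt_sqrt_of_sq_lt
      have : 0 < (α2 s) ^ 2 := by positivity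
      nlinarith
    rw [hrec2 s]
    refine ⟨by linarith, ?_⟩
    nlinarith
  have h2pos : ∀ s, 0 < α2 s := by
    intro s
    induction s with
    | zero => rw [h20]; positivity
    | succ s ih => exact (key s ih).1
  have h2rec : ∀ s, (α2 (s + 1)) ^ 2 = (1 - α2 (s + 1)) * (α2 s) ^ 2 :=
    fun s => (key s (h2pos s)).2
  have h2lt : ∀ s, 0 < 1 - α2 (s + 1) := by
    intro s
    have h1 : 0 < (1 - α2 (s + 1)) * (α2 s) ^ 2 := by
      rw [← h2rec s]; have := h2pos (s + 1); positivity
    have h2 : 0 < (α2 s) ^ 2 := by have := h2pos s; positivity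
    exact (pos_iff_pos_of_mul_pos h1).2 h2
  have h2bd : ∀ s : ℕ, α2 s * ((s : ℝ) + ν) ≤ 2 := by
    intro s
    induction s with
    | zero => rw [h20]; simp; field_simp; exact le_refl _
    | succ s ih =>
      by_contra hc
      push Not at hc
      push_cast at hc
      have hs0 : (0 : ℝ) ≤ s := Nat.cast_nonneg s
      have hb := h2pos (s + 1)
      have ha := h2pos s
      have hlt := h2lt s
      have hrec := h2rec s
      have e1 : (α2 s * ((s : ℝ) + ν)) ^ 2 ≤ 4 := by
        have : 0 ≤ α2 s * ((s : ℝ) + ν) := by positivity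
        nlinarith
      have e2 : (α2 (s + 1) * ((s : ℝ) + ν)) ^ 2 ≤ (1 - α2 (s + 1)) * 4 := by
        rw [mul_pow, hrec, mul_assoc, ← mul_pow]
        exact mul_le_mul_of_nonneg_left e1 hlt.le
      have e3 : 2 - α2 (s + 1) < α2 (s + 1) * ((s : ℝ) + ν) := by nlinarith
      have e4 : (2 - α2 (s + 1)) ^ 2 < (α2 (s + 1) * ((s : ℝ) + ν)) ^ 2 := by
        apply pow_lt_pow_left₀ e3 (by linarith) (by norm_num)
      nlinarith
  have h2dec : ∀ s, α2 (s + 1) ≤ α2 s := by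
    intro s
    have ha := h2pos s
    have hb := h2pos (s + 1)
    refine (pow_le_pow_iff_left₀ hb.le ha.le (two_ne_zero)).1 ?_
    rw [h2rec s]
    nlinarith [mul_pos hb (pow_pos ha 2)]
  have h1nn : ∀ s, 0 ≤ α1 s := by
    intro s
    induction s with
    | zero =>
      have : (ν - 2) / ν = 1 - 2 / ν := by field_simp
      rw [h10, h20]; linarith
    | succ s ih => rw [hrec1]; exact mul_nonneg ih (h2lt s).le
  have h3eq : ∀ s, α3 s = 1 - α1 s - α2 s := by
    intro s
    cases s with
    | zero => linarith
    | succ s => exact hrec3 s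
  have h3ge : ∀ s, α3 0 ≤ α3 s := by
    intro s
    induction s with
    | zero => exact le_refl _
    | succ s ih =>
      have e1 := h3eq s
      have e2 := h3eq (s + 1)
      have e3 := hrec1 s
      have e4 := mul_nonneg (h1nn s) (h2pos (s + 1)).le
      have e5 := h2dec s
      nlinarith
  -- epoch inequality
  have epoch : ∀ s, (1 - α1 s) * (m * dt (s + 1)) + α1 s * d ((s + 1) * m) ≤
      α3 s * (m * dt s) + α1 s * d (s * m) +
        (L s * (α2 s) ^ 2 * (B : ℝ) ^ 2 / 2) * (r (s * m) - r ((s + 1) * m)) := by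
    intro s
    have part : ∀ n : ℕ, n ≤ m →
        (1 - α1 s) * (∑ j ∈ Finset.Icc 1 n, d (s * m + j)) + α1 s * d (s * m + n) ≤
        α3 s * (n * dt s) + α1 s * d (s * m) +
        (L s * (α2 s) ^ 2 * (B : ℝ) ^ 2 / 2) * (r (s * m) - r (s * m + n)) := by
      intro n
      induction n with
      | zero => intro _; simp
      | succ n ih =>
        intro hn
        have h := ih (by omega)
        have hi := hiter s (s * m + (n + 1)) (by omega) (by rw [Nat.succ_mul]; omega)
        rw [show s * m + (n + 1) - 1 = s * m + n by omega] at hi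
        rw [Finset.sum_Icc_succ_top (by omega)]
        push_cast
        linarith
    have h := part m le_rfl
    rw [show s * m + m = (s + 1) * m by ring] at h
    have h1 : 0 ≤ 1 - α1 s := by
      have := h3eq s; have := h3ge s; have := h2pos s; linarith
    have := mul_le_mul_of_nonneg_left (hsnap s) h1
    linarith
  have pot : ∀ s, α3 s / (α2 s) ^ 2 * (m * dt s) + α1 s / (α2 s) ^ 2 * d (s * m) +
      L s * (B : ℝ) ^ 2 / 2 * r (s * m) ≤
      α3 0 / (α2 0) ^ 2 * (m * d 0) + α1 0 / (α2 0) ^ 2 * d 0 +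
      L 0 * (B : ℝ) ^ 2 / 2 * r 0 := by
    intro s
    induction s with
    | zero => simp [hdt0]
    | succ s ih =>
      refine le_trans ?_ ih
      have ha : 0 < (α2 s) ^ 2 := pow_pos (h2pos s) 2
      have hl := h2lt s
      have e1 : α1 (s + 1) / (α2 (s + 1)) ^ 2 = α1 s / (α2 s) ^ 2 := by
        rw [hrec1, h2rec]; field_simp
      have e3 : α3 (s + 1) / (α2 (s + 1)) ^ 2 = (1 - α1 s) / (α2 s) ^ 2 := by
        rw [hrec3, hrec1, h2rec, div_eq_div_iff (by positivity) (by positivity)]; ring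
      rw [e1, e3]
      have h := div_le_div_of_nonneg_right (epoch s) ha.le
      have l1 : ((1 - α1 s) * (m * dt (s + 1)) + α1 s * d ((s + 1) * m)) / (α2 s) ^ 2 =
        (1 - α1 s) / (α2 s) ^ 2 * (m * dt (s + 1)) +
          α1 s / (α2 s) ^ 2 * d ((s + 1) * m) := by ring
      have l2 : (α3 s * (m * dt s) + α1 s * d (s * m) +
        (L s * (α2 s) ^ 2 * (B : ℝ) ^ 2 / 2) * (r (s * m) - r ((s + 1) * m))) / (α2 s) ^ 2 =
        α3 s / (α2 s) ^ 2 * (m * dt s) + α1 s / (α2 s) ^ 2 * d (s * m) +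
        L s * (B : ℝ) ^ 2 / 2 * (r (s * m) - r ((s + 1) * m)) := by
        have := (h2pos s).ne'
        field_simp
      rw [l1, l2] at h
      have hB2 : 0 ≤ (B : ℝ) ^ 2 / 2 * r ((s + 1) * m) := by
        have := hr ((s + 1) * m); positivity
      have := mul_le_mul_of_nonneg_right (hLmono s) hB2
      linarith
  intro s _
  have hp := pot s
  have ha : 0 < (α2 s) ^ 2 := pow_pos (h2pos s) 2
  have ht : 0 < (s : ℝ) + ν := by positivity
  have n1 : 0 ≤ α1 s / (α2 s) ^ 2 * d (s * m) :=
    mul_nonneg (div_nonneg (h1nn s) ha.le) (hd _)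
  have n2 : 0 ≤ L s * (B : ℝ) ^ 2 / 2 * r (s * m) := by
    have := hr (s * m); have := hL s; positivity
  have low : α3 0 * ((s : ℝ) + ν) ^ 2 / 4 ≤ α3 s / (α2 s) ^ 2 := by
    rw [div_le_div_iff₀ (by norm_num) ha]
    have e0 : 0 ≤ α2 s * ((s : ℝ) + ν) := mul_nonneg (h2pos s).le ht.le
    have e1 : (α2 s * ((s : ℝ) + ν)) ^ 2 ≤ 4 := by nlinarith [h2bd s]
    have e2 := mul_le_mul_of_nonneg_left e1 h30.le
    have e3 := h3ge s
    nlinarith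
  have low2 := mul_le_mul_of_nonneg_right low (mul_nonneg hmpos.le (hdt s))
  have fin : α3 0 * ((s : ℝ) + ν) ^ 2 / 4 * (m * dt s) ≤
      α3 0 / (α2 0) ^ 2 * (m * d 0) + α1 0 / (α2 0) ^ 2 * d 0 +
      L 0 * (B : ℝ) ^ 2 / 2 * r 0 := by linarith
  have hc : 0 < α3 0 * ((s : ℝ) + ν) ^ 2 / 4 * m := by positivity
  rw [← mul_assoc, mul_comm _ (dt s)] at fin
  have h := (le_div_iff₀ hc).2 fin
  refine h.trans (le_of_eq ?_)
  have := (h2pos 0).ne'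
  field_simp
  try ring
end

section
/- Under the hypotheses of the sequence form of Theorem 2 (B ≥ 2; α_{2,0} = α_{3,0} = 1/(2B), α_{1,0} = 1 - 1/B, with α_{i,s} generated by the recurrences; nonincreasing positive L̄_s; sequences 0 ≤ d_k ≤ d̂_k, r_k ≥ 0, d̃_s ≥ 0 with d̂_0 = d̃_0 = d_0 satisfying d̂_k ≤ α_{3,s} d̃_s + α_{1,s} d̂_{k-1} + (L̄_s α_{2,s}^2 B^2/2)(r_{k-1} - r_k) for sm+1 ≤ k ≤ (s+1)m and m d̃_{s+1} ≤ Σ_{j=1}^m d_{sm+j}), one has for every s ≥ 1: d̃_s ≤ (8B / (s + 4B)^2) · ( (α_{1,0}/α_{2,0}^2)(d_0/m) + (α_{3,0}/α_{2,0}^2) d_0 + (L̄_0 B^2/(2m)) r_0 ). In particular d̃_s = O(B/s²). -/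
theorem le_of_sq_le_sq_aux {a b : ℝ} (h : a ^ 2 ≤ b ^ 2) (hb : 0 ≤ b) : a ≤ b := by
  exact le_of_abs_le ((sq_le_sq.mp h).trans_eq (abs_of_nonneg hb))

/-- Corollary 2 of the AVRBCD paper in explicit form: under the hypotheses of
the sequence form of Theorem 2 (`B ≥ 2`; `α_{2,0} = α_{3,0} = 1/(2B)`,
`α_{1,0} = 1 - 1/B`, parameters generated by the AVRBCD recurrences;
nonincreasing positive `L̄_s`; sequences `0 ≤ d_k ≤ d̂_k`, `r_k ≥ 0`, `d̃_s ≥ 0`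
with `d̂_0 = d̃_0 = d_0`, the per-iteration inequality and the snapshot
inequality), one has for every `s ≥ 1`:
`d̃_s ≤ (8B/(s + 4B)²)((α_{1,0}/α_{2,0}²)(d_0/m) + (α_{3,0}/α_{2,0}²) d_0
+ (L̄_0 B²/(2m)) r_0)`, i.e. `d̃_s = O(B/s²)`. -/
theorem avrbcd_proximal_rate (B m : ℕ) (hB : 2 ≤ B) (hm : 1 ≤ m)
    (α1 α2 α3 : ℕ → ℝ)
    (h20 : α2 0 = 1 / (2 * (B : ℝ))) (h30 : α3 0 = 1 / (2 * (B : ℝ)))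
    (h10 : α1 0 = 1 - 1 / (B : ℝ))
    (hrec2 : ∀ s : ℕ,
      α2 (s + 1) = (Real.sqrt ((α2 s) ^ 4 + 4 * (α2 s) ^ 2) - (α2 s) ^ 2) / 2)
    (hrec1 : ∀ s : ℕ, α1 (s + 1) = α1 s * (1 - α2 (s + 1)))
    (hrec3 : ∀ s : ℕ, α3 (s + 1) = 1 - α1 (s + 1) - α2 (s + 1))
    (L : ℕ → ℝ) (hL : ∀ s, 0 < L s) (hLmono : ∀ s, L (s + 1) ≤ L s)
    (d dh dt r : ℕ → ℝ)
    (hd : ∀ k, 0 ≤ d k) (hdh : ∀ k, d k ≤ dh k)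
    (hr : ∀ k, 0 ≤ r k) (hdt : ∀ s, 0 ≤ dt s)
    (hdh0 : dh 0 = d 0) (hdt0 : dt 0 = d 0)
    (hiter : ∀ s k : ℕ, s * m + 1 ≤ k → k ≤ (s + 1) * m →
      dh k ≤ α3 s * dt s + α1 s * dh (k - 1) +
        (L s * (α2 s) ^ 2 * (B : ℝ) ^ 2 / 2) * (r (k - 1) - r k))
    (hsnap : ∀ s : ℕ, (m : ℝ) * dt (s + 1) ≤ ∑ j ∈ Finset.Icc 1 m, d (s * m + j)) :
    ∀ s : ℕ, 1 ≤ s →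
      dt s ≤ (8 * (B : ℝ) / ((s : ℝ) + 4 * (B : ℝ)) ^ 2) *
        ((α1 0 / (α2 0) ^ 2) * (d 0 / (m : ℝ)) + (α3 0 / (α2 0) ^ 2) * d 0 +
          (L 0 * (B : ℝ) ^ 2 / (2 * (m : ℝ))) * r 0) := by
  have hB' : (2 : ℝ) ≤ B := by exact_mod_cast hB
  have hm' : (1 : ℝ) ≤ m := by exact_mod_cast hm
  -- properties of α2
  have hpos : ∀ s, 0 < α2 s := by
    intro s
    induction s with
    | zero => rw [h20]; positivity
    | succ s ih =>
      rw [hrec2]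
      have : (α2 s) ^ 2 < Real.sqrt ((α2 s) ^ 4 + 4 * (α2 s) ^ 2) := by
        apply Real.lt_sqrt_of_sq_lt
        have : 0 < (α2 s) ^ 2 := by positivity
        nlinarith
      linarith
  have hquad : ∀ s, (α2 (s + 1)) ^ 2 = (α2 s) ^ 2 * (1 - α2 (s + 1)) := by
    intro s
    have h := Real.sq_sqrt (show 0 ≤ (α2 s) ^ 4 + 4 * (α2 s) ^ 2 by positivity)
    have h2 := hrec2 s
    generalize Real.sqrt ((α2 s) ^ 4 + 4 * (α2 s) ^ 2) = q at h h2
    have hq : q = 2 * α2 (s + 1) + (α2 s) ^ 2 := by linarith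
    subst hq
    nlinarith
  have hanti : ∀ s, α2 (s + 1) ≤ α2 s := by
    intro s
    have h1 := hpos s
    have h2 := hpos (s + 1)
    have h3 := hquad s
    refine le_of_sq_le_sq_aux ?_ h1.le
    nlinarith [mul_pos (pow_pos h1 2) h2]
  have hle0 : ∀ s, α2 s ≤ α2 0 := by
    intro s
    induction s with
    | zero => exact le_rfl
    | succ s ih => exact (hanti s).trans ih
  have hu : ∀ s : ℕ, ((s : ℝ) + 4 * B) / 2 ≤ 1 / α2 s := by
    intro s
    induction s with
    | zero => rw [h20]; simp; linarith
    | succ s ih =>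
      have h1 := hpos s
      have h2 := hpos (s + 1)
      have h3 := hquad s
      have e : (1 / α2 (s + 1) - 1 / 2) ^ 2 = (1 / α2 s) ^ 2 + 1 / 4 := by
        field_simp
        nlinarith
      have hs1 : 1 / α2 s ≤ 1 / α2 (s + 1) := one_div_le_one_div_of_le h2 (hanti s)
      have hs0 : (0 : ℝ) ≤ s := Nat.cast_nonneg s
      have : 1 / α2 s ≤ 1 / α2 (s + 1) - 1 / 2 := by
        refine le_of_sq_le_sq_aux ?_ (by linarith)
        linarith
      push_cast
      linarith
  obtain ⟨c, hc⟩ : ∃ c, c = α1 0 / (α2 0) ^ 2 := ⟨_, rfl⟩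
  have hc0 : 0 ≤ c := by
    rw [hc, h10]
    apply div_nonneg _ (sq_nonneg _)
    have : 1 / (B : ℝ) ≤ 1 := by
      rw [div_le_one (by linarith)]; linarith
    linarith
  have h1c : ∀ s, α1 s = c * (α2 s) ^ 2 := by
    intro s
    induction s with
    | zero =>
      have := hpos 0
      rw [hc]; field_simp
    | succ s ih => rw [hrec1, ih, hquad]; ring
  have hsum : ∀ s, α3 s = 1 - α1 s - α2 s := by
    intro s
    cases s with
    | zero => rw [h30, h10, h20]; field_simp; ring
    | succ s => exact hrec3 s
  have h3ge : ∀ s, 1 / (2 * (B : ℝ)) ≤ α3 s := by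
    intro s
    rw [← h30, hsum s, hsum 0, h1c s, h1c 0]
    have h1 := hle0 s
    have h2 := hpos s
    have : (α2 s) ^ 2 ≤ (α2 0) ^ 2 := by gcongr
    nlinarith
  -- epoch summation
  have hepoch : ∀ s j : ℕ, j ≤ m →
      (1 - α1 s) * ∑ i ∈ Finset.Icc 1 j, dh (s * m + i) + α1 s * dh (s * m + j) ≤
        j * (α3 s * dt s) + α1 s * dh (s * m) +
        (L s * (α2 s) ^ 2 * (B : ℝ) ^ 2 / 2) * (r (s * m) - r (s * m + j)) := by
    intro s j
    induction j with
    | zero => intro _; simp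
    | succ j ih =>
      intro hj
      have h1 := ih (by omega)
      have h2 := hiter s (s * m + (j + 1)) (by omega) (by rw [add_mul]; omega)
      rw [show s * m + (j + 1) - 1 = s * m + j by omega] at h2
      rw [Finset.sum_Icc_succ_top (by omega)]
      push_cast
      linarith
  have hstep : ∀ s, (m : ℝ) * (α3 (s + 1) / (α2 (s + 1)) ^ 2) * dt (s + 1) +
      c * dh ((s + 1) * m) + L (s + 1) * (B : ℝ) ^ 2 / 2 * r ((s + 1) * m) ≤
      (m : ℝ) * (α3 s / (α2 s) ^ 2) * dt s + c * dh (s * m) +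
        L s * (B : ℝ) ^ 2 / 2 * r (s * m) := by
    intro s
    have ha := hpos s
    have ha' := hpos (s + 1)
    have hq := hquad s
    have h := hepoch s m le_rfl
    have hS : (m : ℝ) * dt (s + 1) ≤ ∑ i ∈ Finset.Icc 1 m, dh (s * m + i) :=
      (hsnap s).trans (Finset.sum_le_sum fun i _ => hdh _)
    have h1 : 0 ≤ 1 - α1 s := by
      have := hsum s
      have := h3ge s
      have : 0 ≤ 1 / (2 * (B : ℝ)) := by positivity
      linarith
    have h4 := mul_le_mul_of_nonneg_left hS h1
    have key : α3 (s + 1) / (α2 (s + 1)) ^ 2 = (1 - α1 s) / (α2 s) ^ 2 := by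
      rw [div_eq_div_iff (by positivity) (by positivity), hrec3, hrec1, hq]
      have e := h1c s
      have : (1 - α2 (s + 1)) * (α2 s) ^ 2 = (α2 (s + 1)) ^ 2 := by rw [hq]; ring
      linear_combination 0 * this
    have hr' : L (s + 1) * (B : ℝ) ^ 2 / 2 * r ((s + 1) * m) ≤
        L s * (B : ℝ) ^ 2 / 2 * r ((s + 1) * m) := by
      have := hLmono s
      have := hr ((s + 1) * m)
      gcongr
    have e1 : s * m + m = (s + 1) * m := by ring
    rw [e1, h1c s] at h
    rw [h1c s] at h4
    rw [key, h1c s]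
    have h5 : ((1 - c * α2 s ^ 2) * (m * dt (s + 1)) + c * α2 s ^ 2 * dh ((s + 1) * m)) / α2 s ^ 2 ≤
      (m * (α3 s * dt s) + c * α2 s ^ 2 * dh (s * m) +
        (L s * (α2 s) ^ 2 * (B : ℝ) ^ 2 / 2) * (r (s * m) - r ((s + 1) * m))) / α2 s ^ 2 := by
      apply div_le_div_of_nonneg_right _ (sq_nonneg _)
      linarith
    have e2 : ((1 - c * α2 s ^ 2) * (m * dt (s + 1)) + c * α2 s ^ 2 * dh ((s + 1) * m)) / α2 s ^ 2
      = m * ((1 - c * α2 s ^ 2) / α2 s ^ 2) * dt (s + 1) + c * dh ((s + 1) * m) := by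
      field_simp
    have e3 : (m * (α3 s * dt s) + c * α2 s ^ 2 * dh (s * m) +
        (L s * (α2 s) ^ 2 * (B : ℝ) ^ 2 / 2) * (r (s * m) - r ((s + 1) * m))) / α2 s ^ 2
      = m * (α3 s / α2 s ^ 2) * dt s + c * dh (s * m) +
        L s * (B : ℝ) ^ 2 / 2 * (r (s * m) - r ((s + 1) * m)) := by
      field_simp
    rw [e2, e3] at h5
    linarith
  have hT : ∀ s, (m : ℝ) * (α3 s / (α2 s) ^ 2) * dt s + c * dh (s * m) +
        L s * (B : ℝ) ^ 2 / 2 * r (s * m) ≤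
      (m : ℝ) * (α3 0 / (α2 0) ^ 2) * d 0 + c * d 0 + L 0 * (B : ℝ) ^ 2 / 2 * r 0 := by
    intro s
    induction s with
    | zero => simp [hdt0, hdh0]
    | succ s ih => exact (hstep s).trans ih
  intro s _
  rw [← hc]
  set K := c * (d 0 / (m : ℝ)) + (α3 0 / (α2 0) ^ 2) * d 0 +
          (L 0 * (B : ℝ) ^ 2 / (2 * (m : ℝ))) * r 0 with hK
  have hmK : (m : ℝ) * K =
      (m : ℝ) * (α3 0 / (α2 0) ^ 2) * d 0 + c * d 0 + L 0 * (B : ℝ) ^ 2 / 2 * r 0 := by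
    rw [hK]; field_simp; ring
  have hmain : (α3 s / (α2 s) ^ 2) * dt s ≤ K := by
    have h := hT s
    rw [← hmK] at h
    have h1 : 0 ≤ c * dh (s * m) := mul_nonneg hc0 ((hd _).trans (hdh _))
    have h2 : 0 ≤ L s * (B : ℝ) ^ 2 / 2 * r (s * m) := by
      have := hL s
      have := hr (s * m)
      positivity
    have h3 : (m : ℝ) * ((α3 s / (α2 s) ^ 2) * dt s) ≤ m * K := by linarith
    exact le_of_mul_le_mul_left h3 (by linarith)
  have hs0 : (0 : ℝ) ≤ s := Nat.cast_nonneg s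
  have hcoef : ((s : ℝ) + 4 * B) ^ 2 / (8 * B) ≤ α3 s / (α2 s) ^ 2 := by
    have e : α3 s / (α2 s) ^ 2 = α3 s * (1 / α2 s) ^ 2 := by
      rw [one_div, inv_pow, div_eq_mul_inv]
    have e' : ((s : ℝ) + 4 * B) ^ 2 / (8 * B) =
        1 / (2 * (B : ℝ)) * (((s : ℝ) + 4 * B) / 2) ^ 2 := by
      field_simp; ring
    rw [e, e']
    have := h3ge s
    have := hu s
    have : 0 ≤ α3 s := le_trans (by positivity) (h3ge s)
    gcongr
  have h6 := (mul_le_mul_of_nonneg_right hcoef (hdt s)).trans hmain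
  have h7 : dt s = (8 * (B : ℝ) / ((s : ℝ) + 4 * (B : ℝ)) ^ 2) *
      (((s : ℝ) + 4 * B) ^ 2 / (8 * B) * dt s) := by
    field_simp
  rw [h7]
  exact mul_le_mul_of_nonneg_left h6 (by positivity)
end

section
/- Under the hypotheses of the sequence form of Theorem 1 (parameters α_{i,s} generated from α_{1,0}, α_{2,0}, α_{3,0} ∈ (0,1) summing to 1 by the recurrences α_{2,s} = (sqrt(α_{2,s-1}^4 + 4α_{2,s-1}^2) - α_{2,s-1}^2)/2, α_{1,s} = α_{1,s-1}(1 - α_{2,s}), α_{3,s} = 1 - α_{1,s} - α_{2,s}; nonincreasing positive L̄_s; nonnegative sequences d_k, d̃_s, r_k satisfying d_k ≤ α_{3,s} d̃_s + α_{1,s} d_{k-1} + (L̄_s α_{2,s}^2 B^2/2)(r_{k-1} - r_k) for sm+1 ≤ k ≤ (s+1)m and m d̃_{s+1} ≤ Σ_{j=1}^m d_{sm+j}), the Lyapunov quantity Φ_s := (α_{1,s}/α_{2,s}^2) d_{sm} + (α_{3,s}/α_{2,s}^2) m d̃_s + (L̄_s B^2/2) r_{sm} is nonincreasing in s, i.e.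 Φ_{s+1} ≤ Φ_s for all s ≥ 0. -/
/-- The key telescoping inequality in the proofs of Theorems 1 and 2 of the
AVRBCD paper: with parameters `α_{1,0}, α_{2,0}, α_{3,0} ∈ (0,1)` summing to
one and generated by the AVRBCD recurrences, nonincreasing positive `L̄_s`, and
nonnegative sequences `d_k, d̃_s, r_k` satisfying the per-iteration inequality
and the snapshot inequality, the epoch potential
`Φ_s = (α_{1,s}/α_{2,s}²) d_{sm} + (α_{3,s}/α_{2,s}²) m d̃_s + (L̄_s B²/2) r_{sm}`
is nonincreasing in `s`. -/
theorem avrbcd_lyapunov_decrease (B m : ℕ) (hB : 1 ≤ B) (hm : 1 ≤ m)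
    (α1 α2 α3 : ℕ → ℝ)
    (h10 : 0 < α1 0) (h10' : α1 0 < 1)
    (h20 : 0 < α2 0) (h20' : α2 0 < 1)
    (h30 : 0 < α3 0) (h30' : α3 0 < 1)
    (hsum : α1 0 + α2 0 + α3 0 = 1)
    (hrec2 : ∀ s : ℕ,
      α2 (s + 1) = (Real.sqrt ((α2 s) ^ 4 + 4 * (α2 s) ^ 2) - (α2 s) ^ 2) / 2)
    (hrec1 : ∀ s : ℕ, α1 (s + 1) = α1 s * (1 - α2 (s + 1)))
    (hrec3 : ∀ s : ℕ, α3 (s + 1) = 1 - α1 (s + 1) - α2 (s + 1))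
    (L : ℕ → ℝ) (hL : ∀ s, 0 < L s) (hLmono : ∀ s, L (s + 1) ≤ L s)
    (d dt r : ℕ → ℝ)
    (hd : ∀ k, 0 ≤ d k) (hdt : ∀ s, 0 ≤ dt s) (hr : ∀ k, 0 ≤ r k)
    (hiter : ∀ s k : ℕ, s * m + 1 ≤ k → k ≤ (s + 1) * m →
      d k ≤ α3 s * dt s + α1 s * d (k - 1) +
        (L s * (α2 s) ^ 2 * (B : ℝ) ^ 2 / 2) * (r (k - 1) - r k))
    (hsnap : ∀ s : ℕ, (m : ℝ) * dt (s + 1) ≤ ∑ j ∈ Finset.Icc 1 m, d (s * m + j)) :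
    ∀ s : ℕ,
      (α1 (s + 1) / (α2 (s + 1)) ^ 2) * d ((s + 1) * m) +
          (α3 (s + 1) / (α2 (s + 1)) ^ 2) * (m : ℝ) * dt (s + 1) +
          (L (s + 1) * (B : ℝ) ^ 2 / 2) * r ((s + 1) * m)
        ≤ (α1 s / (α2 s) ^ 2) * d (s * m) +
            (α3 s / (α2 s) ^ 2) * (m : ℝ) * dt s +
            (L s * (B : ℝ) ^ 2 / 2) * r (s * m) := by
  have ha : ∀ s, 0 < α2 s := by
    intro s
    induction s with
    | zero => exact h20
    | succ k ih =>
      rw [hrec2 k]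
      have : (α2 k) ^ 2 < Real.sqrt ((α2 k) ^ 4 + 4 * (α2 k) ^ 2) := by
        apply Real.lt_sqrt_of_sq_lt
        nlinarith [pow_pos ih 2]
      linarith
  have hq : ∀ s, (α2 (s + 1)) ^ 2 = (α2 s) ^ 2 * (1 - α2 (s + 1)) := by
    intro s
    have h := Real.sq_sqrt (show 0 ≤ (α2 s) ^ 4 + 4 * (α2 s) ^ 2 by positivity)
    have h2 : Real.sqrt ((α2 s) ^ 4 + 4 * (α2 s) ^ 2) = 2 * α2 (s + 1) + (α2 s) ^ 2 := by
      rw [hrec2 s]; ring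
    rw [h2] at h
    linarith
  have hb : ∀ s, 0 < 1 - α2 (s + 1) := by
    intro s
    have h1 := pow_pos (ha s) 2
    have h2 := pow_pos (ha (s + 1)) 2
    rw [hq s] at h2
    exact (pos_iff_pos_of_mul_pos h2).1 h1
  have h1 : ∀ s, 0 < α1 s ∧ α1 s < 1 := by
    intro s
    induction s with
    | zero => exact ⟨h10, h10'⟩
    | succ k ih =>
      rw [hrec1 k]
      refine ⟨mul_pos ih.1 (hb k), ?_⟩
      nlinarith [mul_pos ih.1 (ha (k + 1)), ih.2]
  intro s
  have key : ∀ n : ℕ, n ≤ m →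
      (1 - α1 s) * ∑ j ∈ Finset.Icc 1 n, d (s * m + j) + α1 s * d (s * m + n) ≤
      n * (α3 s * dt s) + α1 s * d (s * m) +
        (L s * (α2 s) ^ 2 * (B : ℝ) ^ 2 / 2) * (r (s * m) - r (s * m + n)) := by
    intro n
    induction n with
    | zero => intro _; simp
    | succ n ih =>
      intro hn
      have h := ih (by omega)
      have h' := hiter s (s * m + (n + 1)) (by omega) (by rw [Nat.add_mul]; omega)
      have e : s * m + (n + 1) - 1 = s * m + n := by omega
      rw [e] at h'
      rw [Finset.sum_Icc_succ_top (by omega)]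
      push_cast
      linarith
  have hk := key m le_rfl
  have em : s * m + m = (s + 1) * m := by ring
  rw [em] at hk
  have hA := pow_pos (ha s) 2
  have hB1 := hb s
  have e1 : α1 (s + 1) / (α2 (s + 1)) ^ 2 = α1 s / (α2 s) ^ 2 := by
    rw [hrec1, hq, mul_div_mul_right _ _ hB1.ne']
  have e3 : α3 (s + 1) / (α2 (s + 1)) ^ 2 = (1 - α1 s) / (α2 s) ^ 2 := by
    rw [hrec3, hrec1, hq, ← mul_div_mul_right (1 - α1 s) _ hB1.ne']
    congr 1; ring
  rw [e1, e3]
  have hs := mul_le_mul_of_nonneg_left (hsnap s) (sub_nonneg.2 (h1 s).2.le)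
  have hLr : (L (s + 1) * (B : ℝ) ^ 2 / 2) * r ((s + 1) * m) ≤
      (L s * (B : ℝ) ^ 2 / 2) * r ((s + 1) * m) := by
    have := hLmono s
    have := hr ((s + 1) * m)
    gcongr
  have hdiv : (α1 s * d ((s + 1) * m) + (1 - α1 s) * (m * dt (s + 1))) / (α2 s) ^ 2 ≤
      (m * (α3 s * dt s) + α1 s * d (s * m) +
        (L s * (α2 s) ^ 2 * (B : ℝ) ^ 2 / 2) * (r (s * m) - r ((s + 1) * m))) / (α2 s) ^ 2 :=
    div_le_div_of_nonneg_right (by linarith) hA.le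
  have e4 : (m * (α3 s * dt s) + α1 s * d (s * m) +
        (L s * (α2 s) ^ 2 * (B : ℝ) ^ 2 / 2) * (r (s * m) - r ((s + 1) * m))) / (α2 s) ^ 2
      = (α1 s / (α2 s) ^ 2) * d (s * m) + (α3 s / (α2 s) ^ 2) * (m : ℝ) * dt s +
        (L s * (B : ℝ) ^ 2 / 2) * (r (s * m) - r ((s + 1) * m)) := by
    have := (ha s).ne'
    field_simp
    ring
  have e5 : (α1 s * d ((s + 1) * m) + (1 - α1 s) * (m * dt (s + 1))) / (α2 s) ^ 2
      = (α1 s / (α2 s) ^ 2) * d ((s + 1) * m) +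
        ((1 - α1 s) / (α2 s) ^ 2) * (m : ℝ) * dt (s + 1) := by ring
  rw [e4, e5] at hdiv
  linarith
end

section
/- Let f_1, …, f_n : ℝ^d → ℝ be differentiable convex functions, each f_i being L_i-smooth, and let L_max = max_i L_i and F = (1/n) Σ_{i=1}^n f_i. For y, x̃ ∈ ℝ^d define the variance-reduced gradients v_i = ∇f_i(y) - ∇f_i(x̃) + ∇F(x̃). Then (1/n) Σ_{i=1}^n ‖v_i - ∇F(y)‖² ≤ 2 L_max ( F(x̃) - F(y) - ⟨∇F(y), x̃ - y⟩ ). -/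
open RealInnerProductSpace

theorem grad_ineq_aux {d : ℕ} (f : EuclideanSpace ℝ (Fin d) → ℝ)
    (hdiff : Differentiable ℝ f) (hconv : ConvexOn ℝ Set.univ f)
    (y w : EuclideanSpace ℝ (Fin d)) :
    f y + ⟪gradient f y, w - y⟫ ≤ f w := by
  have hline : HasDerivAt (fun t : ℝ => f (AffineMap.lineMap y w t)) ⟪gradient f y, w - y⟫ 0 := by
    have h1 : HasFDerivAt f (InnerProductSpace.toDual ℝ _ (gradient f y))
        (AffineMap.lineMap y w (0 : ℝ)) := by
      rw [AffineMap.lineMap_apply_zero]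
      exact (hdiff y).hasGradientAt.hasFDerivAt
    have h2 := h1.comp_hasDerivAt (0 : ℝ) (AffineMap.hasDerivAt_lineMap (a := y) (b := w))
    rw [InnerProductSpace.toDual_apply_apply] at h2
    exact h2
  have hc : ConvexOn ℝ Set.univ (fun t : ℝ => f (AffineMap.lineMap y w t)) := by
    have := hconv.comp_affineMap (AffineMap.lineMap (k := ℝ) y w)
    rw [Set.preimage_univ] at this
    exact this
  have := hc.le_slope_of_hasDerivAt (Set.mem_univ (0 : ℝ)) (Set.mem_univ (1 : ℝ)) one_pos hline
  simp only [slope_def_field, AffineMap.lineMap_apply_zero, AffineMap.lineMap_apply_one, sub_zero,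
    div_one] at this
  linarith

theorem coco_aux {d : ℕ} (f : EuclideanSpace ℝ (Fin d) → ℝ)
    (hdiff : Differentiable ℝ f) (hconv : ConvexOn ℝ Set.univ f) (L : ℝ) (hL : 0 < L)
    (hsmooth : ∀ (x y : EuclideanSpace ℝ (Fin d)),
      f y ≤ f x + ⟪gradient f x, y - x⟫ + L / 2 * ‖x - y‖ ^ 2)
    (y x : EuclideanSpace ℝ (Fin d)) :
    ‖gradient f y - gradient f x‖ ^ 2 ≤ 2 * L * (f x - f y - ⟪gradient f y, x - y⟫) := by
  set D := gradient f y - gradient f x with hD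
  have h1 := grad_ineq_aux f hdiff hconv y (x + L⁻¹ • D)
  have h2 := hsmooth x (x + L⁻¹ • D)
  have e1 : x + L⁻¹ • D - y = (x - y) + L⁻¹ • D := by abel
  have e2 : x + L⁻¹ • D - x = L⁻¹ • D := by abel
  have e3 : x - (x + L⁻¹ • D) = -(L⁻¹ • D) := by abel
  rw [e1, inner_add_right, inner_smul_right] at h1
  rw [e2, e3, norm_neg, norm_smul, inner_smul_right, Real.norm_of_nonneg (by positivity)] at h2
  have e4 : ⟪gradient f y, D⟫ - ⟪gradient f x, D⟫ = ‖D‖ ^ 2 := by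
    rw [← inner_sub_left, ← hD, real_inner_self_eq_norm_sq]
  have e5 : L / 2 * (L⁻¹ * ‖D‖) ^ 2 = L⁻¹ * ‖D‖ ^ 2 / 2 := by field_simp
  have e6 : L⁻¹ * ‖D‖ ^ 2 ≤ 2 * (f x - f y - ⟪gradient f y, x - y⟫) := by
    rw [e5] at h2
    rw [← e4] at h2 ⊢
    linarith
  rw [inv_mul_le_iff₀ hL] at e6
  linarith

theorem svrg_variance_bound (d n : ℕ) (hn : 0 < n)
    (f : Fin n → EuclideanSpace ℝ (Fin d) → ℝ)
    (hdiff : ∀ i, Differentiable ℝ (f i))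
    (hconv : ∀ i, ConvexOn ℝ Set.univ (f i))
    (L : Fin n → ℝ) (hLpos : ∀ i, 0 < L i)
    (hsmooth : ∀ (i : Fin n) (x y : EuclideanSpace ℝ (Fin d)),
      f i y ≤ f i x + ⟪gradient (f i) x, y - x⟫ + L i / 2 * ‖x - y‖ ^ 2)
    (Lmax : ℝ) (hLmax : IsGreatest (Set.range L) Lmax)
    (F : EuclideanSpace ℝ (Fin d) → ℝ)
    (hF : ∀ x, F x = (1 / (n : ℝ)) * ∑ i : Fin n, f i x)
    (y xt : EuclideanSpace ℝ (Fin d))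
    (v : Fin n → EuclideanSpace ℝ (Fin d))
    (hv : ∀ i, v i = gradient (f i) y - gradient (f i) xt + gradient F xt) :
    (1 / (n : ℝ)) * ∑ i : Fin n, ‖v i - gradient F y‖ ^ 2 ≤
      2 * Lmax * (F xt - F y - ⟪gradient F y, xt - y⟫) := by
  have hn' : (0 : ℝ) < n := by exact_mod_cast hn
  have hG : ∀ x, gradient F x = (1 / (n : ℝ)) • ∑ i, gradient (f i) x := by
    intro x
    apply HasGradientAt.gradient
    rw [hasGradientAt_iff_hasFDerivAt]
    have h : HasFDerivAt (fun x => (1 / (n : ℝ)) * ∑ i : Fin n, f i x)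
        ((1 / (n : ℝ)) • ∑ i, InnerProductSpace.toDual ℝ _ (gradient (f i) x)) x :=
      (HasFDerivAt.fun_sum fun i _ => ((hdiff i) x).hasGradientAt.hasFDerivAt).const_mul _
    rw [← funext hF] at h
    simpa using h
  have hb : ∀ i, ‖gradient (f i) y - gradient (f i) xt‖ ^ 2 ≤
      2 * Lmax * (f i xt - f i y - ⟪gradient (f i) y, xt - y⟫) := by
    intro i
    refine (coco_aux (f i) (hdiff i) (hconv i) (L i) (hLpos i) (hsmooth i) y xt).trans ?_
    have h1 := grad_ineq_aux (f i) (hdiff i) (hconv i) y xt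
    have h2 := hLmax.2 ⟨i, rfl⟩
    apply mul_le_mul_of_nonneg_right <;> linarith
  set m := gradient F y - gradient F xt with hm
  have hsum : ∑ i, (gradient (f i) y - gradient (f i) xt) = (n : ℝ) • m := by
    rw [hm, hG, hG, ← smul_sub, smul_smul, Finset.sum_sub_distrib, mul_one_div_cancel hn'.ne',
      one_smul]
  have hvar : ∑ i, ‖v i - gradient F y‖ ^ 2 =
      ∑ i, ‖gradient (f i) y - gradient (f i) xt‖ ^ 2 - n * ‖m‖ ^ 2 := by
    have : ∀ i, ‖v i - gradient F y‖ ^ 2 = ‖gradient (f i) y - gradient (f i) xt‖ ^ 2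
        - 2 * ⟪gradient (f i) y - gradient (f i) xt, m⟫ + ‖m‖ ^ 2 := by
      intro i
      rw [← norm_sub_sq_real, hv, hm]
      congr 2
      abel
    simp_rw [this]
    rw [Finset.sum_add_distrib, Finset.sum_sub_distrib, ← Finset.mul_sum, ← sum_inner, hsum,
      real_inner_smul_left, real_inner_self_eq_norm_sq]
    simp
    ring
  have hrhs : 2 * Lmax * (F xt - F y - ⟪gradient F y, xt - y⟫) = (1 / (n : ℝ)) *
      ∑ i, 2 * Lmax * (f i xt - f i y - ⟪gradient (f i) y, xt - y⟫) := by
    rw [← Finset.mul_sum, Finset.sum_sub_distrib, Finset.sum_sub_distrib, hF, hF, hG,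
      real_inner_smul_left, sum_inner]
    ring
  rw [hrhs]
  apply mul_le_mul_of_nonneg_left _ (by positivity)
  rw [hvar]
  have := Finset.sum_le_sum (s := Finset.univ) fun i _ => hb i
  have : 0 ≤ n * ‖m‖ ^ 2 := by positivity
  linarith
end

section
/- Let B ≥ 1 be an integer and let α_1, α_2, α_3 ∈ ℝ satisfy α_1 + α_2 + α_3 = 1 and α_1 ≠ 1, and set γ = α_2/(1 - α_1) (so that α_1 γ + α_2 = γ). Let ẋ ∈ ℝ^d, let (β_j)_{j≥0} be nonzero reals with β_j = α_1 β_{j-1}, and let (ẑ_j)_{j≥0}, (u_j)_{j≥0} be sequences in ℝ^d satisfying u_j = u_{j-1} + ((α_2 B - γ)/β_{j-1})(ẑ_j - ẑ_{j-1}) for j ≥ 1. Define ȳ_j = β_{j-1} u_{j-1} + γ ẑ_{j-1} + ẋ, z̄_j = ẑ_j + ẋ, and x̄_j = β_{j-1} u_j + γ ẑ_j + ẋ. Then for every j ≥ 1: ȳ_j = α_1 x̄_{j-1} + α_2 z̄_{j-1} + α_3 ẋ and x̄_j = ȳ_j + α_2 B (z̄_j - z̄_{j-1}). -/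
/-- Inner-loop content of Proposition 1 of the AVRBCD paper (equivalence of the
implementations AVRBCD I and AVRBCD II). With `α₁ + α₂ + α₃ = 1`, `α₁ ≠ 1`,
`γ = α₂/(1 - α₁)`, nonzero reals `β_j` satisfying `β_j = α₁ β_{j-1}` (with the
conventional `β_{-1}`, indexed over `ℤ`), and sequences `u_j, ẑ_j` in `ℝ^d`
satisfying `u_j = u_{j-1} + ((α₂B - γ)/β_{j-1})(ẑ_j - ẑ_{j-1})`, the quantities
`ȳ_j = β_{j-1} u_{j-1} + γ ẑ_{j-1} + ẋ`, `z̄_j = ẑ_j + ẋ`,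
`x̄_j = β_{j-1} u_j + γ ẑ_j + ẋ` satisfy, for every `j ≥ 1`,
`ȳ_j = α₁ x̄_{j-1} + α₂ z̄_{j-1} + α₃ ẋ` and
`x̄_j = ȳ_j + α₂ B (z̄_j - z̄_{j-1})`. -/
theorem avrbcd_implementation_equiv (d B : ℕ) (hB : 1 ≤ B)
    (α1 α2 α3 γ : ℝ) (hsum : α1 + α2 + α3 = 1) (hα1 : α1 ≠ 1)
    (hγ : γ = α2 / (1 - α1))
    (xd : Fin d → ℝ)
    (β : ℤ → ℝ)
    (hβne : ∀ j : ℤ, -1 ≤ j → β j ≠ 0)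
    (hβrec : ∀ j : ℤ, 0 ≤ j → β j = α1 * β (j - 1))
    (u zh : ℕ → (Fin d → ℝ))
    (hu : ∀ j : ℕ, 1 ≤ j →
      u j = u (j - 1) +
        ((α2 * (B : ℝ) - γ) / β ((j : ℤ) - 1)) • (zh j - zh (j - 1))) :
    ∀ j : ℕ, 1 ≤ j →
      (β ((j : ℤ) - 1) • u (j - 1) + γ • zh (j - 1) + xd
          = α1 • (β (((j - 1 : ℕ) : ℤ) - 1) • u (j - 1) + γ • zh (j - 1) + xd) +
              α2 • (zh (j - 1) + xd) + α3 • xd) ∧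
      (β ((j : ℤ) - 1) • u j + γ • zh j + xd
          = (β ((j : ℤ) - 1) • u (j - 1) + γ • zh (j - 1) + xd) +
              (α2 * (B : ℝ)) • ((zh j + xd) - (zh (j - 1) + xd))) := by
  intro j hj
  have h1 : (1 - α1) ≠ 0 := sub_ne_zero.mpr (Ne.symm hα1)
  have hg : γ * (1 - α1) = α2 := by rw [hγ]; field_simp
  have hb : β ((j : ℤ) - 1) ≠ 0 := hβne _ (by omega)
  have hr : β ((j : ℤ) - 1) = α1 * β (((j - 1 : ℕ) : ℤ) - 1) := by
    rw [hβrec _ (by omega)]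
    congr 2
    omega
  constructor
  · rw [hr]
    funext i
    simp only [Pi.add_apply, Pi.smul_apply, smul_eq_mul]
    linear_combination (zh (j - 1) i) * hg - xd i * hsum
  · have hm : β ((j : ℤ) - 1) * ((α2 * (B : ℝ) - γ) / β ((j : ℤ) - 1)) = α2 * (B : ℝ) - γ :=
      mul_div_cancel₀ _ hb
    funext i
    have hui := congrFun (hu j hj) i
    simp only [Pi.add_apply, Pi.sub_apply, Pi.smul_apply, smul_eq_mul] at hui ⊢
    linear_combination β ((j : ℤ) - 1) * hui + (zh j i - zh (j - 1) i) * hm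
end
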